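/- Let T : G → G be coercive with exchange operator Π := (T + T†) R (R† T† R)⁻¹ R† − Id. Then for every pair (u, p) ∈ G × G one has the equivalence: (u ∈ X and p ∈ X^⊥) if and only if −p + i T(u) = Π(p + i T†(u)). -/

import Mathlib

open LinearMap (adjoint)
open scoped ComplexInnerProductSpace

noncomputable section

variable {G H : Type*}
  [NormedAddCommGroup G] [InnerProductSpace ℂ G] [FiniteDimensional ℂ G]
  [NormedAddCommGroup H] [InnerProductSpace ℂ H] [FiniteDimensional ℂ H]

/-- The exchange operator `Π := (T + T†) R (R† T† R)⁻¹ R† − Id`. -/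
def exchangeOp (R : H →ₗ[ℂ] G) (T : G →ₗ[ℂ] G) : G →ₗ[ℂ] G :=
  (T + adjoint T) ∘ₗ R ∘ₗ Ring.inverse (adjoint R ∘ₗ adjoint T ∘ₗ R) ∘ₗ adjoint R
    - LinearMap.id

theorem injective_of_re_inner_pos {E : Type*} [NormedAddCommGroup E] [InnerProductSpace ℂ E]
    (S : E →ₗ[ℂ] E) (hS : ∀ v : E, v ≠ 0 → 0 < (⟪v, S v⟫).re) : Function.Injective S := by
  refine (injective_iff_map_eq_zero S).2 fun v hv => ?_
  by_contra hne
  simpa [hv] using hS v hne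

theorem re_inner_adjoint_self (T : G →ₗ[ℂ] G) (v : G) :
    (⟪v, adjoint T v⟫).re = (⟪v, T v⟫).re := by
  rw [LinearMap.adjoint_inner_right, ← inner_conj_symm, Complex.conj_re]

theorem injective_add_adjoint_of_coercive (T : G →ₗ[ℂ] G)
    (hT : ∀ v : G, v ≠ 0 → 0 < (⟪v, T v⟫).re) : Function.Injective (T + adjoint T) := by
  refine injective_of_re_inner_pos _ fun v hv => ?_
  rw [LinearMap.add_apply, inner_add_right, Complex.add_re, re_inner_adjoint_self]
  exact add_pos (hT v hv) (hT v hv)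

theorem isUnit_compression_of_coercive (R : H →ₗ[ℂ] G) (hR : Function.Injective R)
    (T : G →ₗ[ℂ] G) (hT : ∀ v : G, v ≠ 0 → 0 < (⟪v, T v⟫).re) :
    IsUnit (adjoint R ∘ₗ adjoint T ∘ₗ R) := by
  rw [LinearMap.isUnit_iff_ker_eq_bot, LinearMap.ker_eq_bot]
  refine injective_of_re_inner_pos _ fun v hv => ?_
  rw [LinearMap.comp_apply, LinearMap.adjoint_inner_right, LinearMap.comp_apply,
    re_inner_adjoint_self]
  exact hT _ ((map_ne_zero_iff R hR).2 hv)

theorem mem_orthogonal_range_iff_adjoint_eq_zero (R : H →ₗ[ℂ] G) (p : G) :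
    p ∈ (LinearMap.range R)ᗮ ↔ adjoint R p = 0 := by
  rw [LinearMap.orthogonal_range, LinearMap.mem_ker]

/-- The exchange relation says that `R (R† T† R)⁻¹ R†` sends `p + i T† u` to `i u`. -/
theorem exchange_relation_iff (R : H →ₗ[ℂ] G)
    (T : G →ₗ[ℂ] G) (hT : ∀ v : G, v ≠ 0 → 0 < (⟪v, T v⟫).re) (u p : G) :
    -p + Complex.I • T u = exchangeOp R T (p + Complex.I • adjoint T u) ↔
      Complex.I • u = R (Ring.inverse (adjoint R ∘ₗ adjoint T ∘ₗ R)
        (adjoint R (p + Complex.I • adjoint T u))) := by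
  rw [exchangeOp, LinearMap.sub_apply, LinearMap.id_apply, eq_sub_iff_add_eq]
  have h : -p + Complex.I • T u + (p + Complex.I • adjoint T u)
      = (T + adjoint T) (Complex.I • u) := by
    rw [map_smul, LinearMap.add_apply, smul_add]
    abel
  rw [h]
  exact (injective_add_adjoint_of_coercive T hT).eq_iff

/-- For coercive `T` with exchange operator `Π`, a pair `(u, p)` satisfies
`u ∈ X` and `p ∈ X^⊥` if and only if `−p + i T u = Π (p + i T† u)`. -/
theorem statement3
    (R : H →ₗ[ℂ] G) (hR : Function.Injective R)
    (T : G →ₗ[ℂ] G) (hT : ∀ v : G, v ≠ 0 → 0 < (⟪v, T v⟫).re)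
    (u p : G) :
    (u ∈ LinearMap.range R ∧ p ∈ (LinearMap.range R)ᗮ) ↔
      -p + Complex.I • T u = exchangeOp R T (p + Complex.I • adjoint T u) := by
  rw [exchange_relation_iff R T hT, mem_orthogonal_range_iff_adjoint_eq_zero]
  have hA := isUnit_compression_of_coercive R hR T hT
  set A := adjoint R ∘ₗ adjoint T ∘ₗ R
  have hA_apply (h : H) : A h = adjoint R (adjoint T (R h)) := rfl
  constructor
  · rintro ⟨⟨h, rfl⟩, hp⟩
    have hinv : Ring.inverse A (A h) = h := LinearMap.congr_fun (Ring.inverse_mul_cancel A hA) h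
    rw [map_add, hp, zero_add, map_smul, ← hA_apply, map_smul, hinv, map_smul]
  · intro hu
    set q := adjoint R (p + Complex.I • adjoint T u) with hq
    have hinv : A (Ring.inverse A q) = q := LinearMap.congr_fun (Ring.mul_inverse_cancel A hA) q
    refine ⟨((LinearMap.range R).smul_mem_iff Complex.I_ne_zero).1 ⟨_, hu.symm⟩, ?_⟩
    rw [hA_apply, ← hu, hq, map_smul, map_add] at hinv
    exact right_eq_add.1 hinv
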